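/- (Corollary 1) Let two copula-update processes be defined on the same probability space with the same ρ ∈ (−1,1), the same integer n ≥ 1, and the same learning rates α_{n+k} = C·(n+k+1)^{−β} with C > 0 and β ∈ (1/2, 1], but with possibly different initializations P_{0,1}, P_{0,2} and sampled sequences, and let P_{∞,1}(y), P_{∞,2}(y) denote the respective almost-sure limits. Then for every fixed y ∈ ℝ and every δ ∈ (0,1), with probability at least 1 − 2δ, |P_{∞,1}(y) − P_{∞,2}(y)| ≥ |P_{0,1}(y) − P_{0,2}(y)| − 2·√(C²·log(2/δ)/(2β − 1)) · n^{1/2 − β}. -/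

import Mathlib

open MeasureTheory ProbabilityTheory Filter Topology

/-- The standard normal cumulative distribution function `Φ`. -/
noncomputable def Phi (t : ℝ) : ℝ := ((gaussianReal 0 1) (Set.Iic t)).toReal

/-- The inverse (quantile function) of the standard normal CDF. -/
noncomputable def PhiInv (u : ℝ) : ℝ := sInf {x : ℝ | u ≤ Phi x}

/-- The Gaussian copula update function `H_ρ(u,v)`, extended by `H_ρ(0,v) = 0` and
`H_ρ(1,v) = 1`. -/
noncomputable def Hcop (ρ u v : ℝ) : ℝ :=
  if u = 0 then 0
  else if u = 1 then 1
  else Phi ((PhiInv u - ρ * PhiInv v) / Real.sqrt (1 - ρ ^ 2))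

/-- The copula-update process of the martingale posterior construction: an initial random
CDF `P₀`, samples `y_{n+k}` whose conditional probability integral transform
`P_{k−1}(y_{n+k})` is uniform on `[0,1]` given `𝓕_{k−1}`, and the recursive Gaussian
copula update `P_k(y) = (1 − α_{n+k})·P_{k−1}(y) + α_{n+k}·H_ρ(P_{k−1}(y), P_{k−1}(y_{n+k}))`.
Here `Pk k ω` is the random function `P_k` and `y k` is the random variable `y_{n+k}`. -/
structure CopulaProcess (Ω : Type*) [mΩ : MeasurableSpace Ω] (P : Measure Ω) where
  /-- the copula parameter `ρ ∈ (−1,1)` -/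
  ρ : ℝ
  hρ : ρ ∈ Set.Ioo (-1 : ℝ) 1
  /-- the number `n` of originally observed data points -/
  n : ℕ
  hn : 1 ≤ n
  /-- the learning rates: `α (n+k)` is the rate `α_{n+k}` used in step `k` -/
  α : ℕ → ℝ
  hα : ∀ k, 1 ≤ k → α (n + k) ∈ Set.Ioo (0 : ℝ) 1
  /-- the filtration `(𝓕_k)_{k ≥ 0}` -/
  ℱ : Filtration ℕ mΩ
  /-- `Pk k ω` is the random distribution function `P_k` -/
  Pk : ℕ → Ω → ℝ → ℝ
  /-- `y k` is the random variable `y_{n+k}` (for `k ≥ 1`) -/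
  y : ℕ → Ω → ℝ
  /-- `P₀(t)` is `𝓕₀`-measurable for every `t` -/
  meas0 : ∀ t : ℝ, StronglyMeasurable[ℱ 0] fun ω => Pk 0 ω t
  /-- `P₀` is continuous -/
  cont0 : ∀ ω, Continuous (Pk 0 ω)
  /-- `P₀` is strictly increasing -/
  strictMono0 : ∀ ω, StrictMono (Pk 0 ω)
  /-- `P₀` takes values in `(0,1)` (it is strictly increasing onto `(0,1)`) -/
  mem0 : ∀ ω t, Pk 0 ω t ∈ Set.Ioo (0 : ℝ) 1
  /-- `P₀` has limit `0` at `−∞` -/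
  tendsto_atBot0 : ∀ ω, Tendsto (Pk 0 ω) atBot (𝓝 0)
  /-- `P₀` has limit `1` at `+∞` -/
  tendsto_atTop0 : ∀ ω, Tendsto (Pk 0 ω) atTop (𝓝 1)
  /-- `y_{n+k}` is `𝓕_k`-measurable -/
  measy : ∀ k, 1 ≤ k → StronglyMeasurable[ℱ k] (y k)
  /-- conditionally on `𝓕_{k−1}`, the random variable `P_{k−1}(y_{n+k})` is uniformly
  distributed on `[0,1]` -/
  unif : ∀ k, 1 ≤ k → ∀ A : Set Ω, MeasurableSet[ℱ (k - 1)] A →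
    ∀ u ∈ Set.Icc (0 : ℝ) 1,
      P (A ∩ {ω | Pk (k - 1) ω (y k ω) ≤ u}) = P A * ENNReal.ofReal u
  /-- the recursive Gaussian copula update defining `P_k` from `P_{k−1}` -/
  step : ∀ k, 1 ≤ k → ∀ ω t,
    Pk k ω t = (1 - α (n + k)) * Pk (k - 1) ω t
      + α (n + k) * Hcop ρ (Pk (k - 1) ω t) (Pk (k - 1) ω (y k ω))

lemma Phi_eq_cdf (x : ℝ) : Phi x = cdf (gaussianReal 0 1) x := by
  rw [cdf_eq_real]; rfl

lemma Phi_nonneg (x : ℝ) : 0 ≤ Phi x := ENNReal.toReal_nonneg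

lemma Phi_le_one (x : ℝ) : Phi x ≤ 1 := Phi_eq_cdf x ▸ cdf_le_one _ x

lemma Phi_strictMono : StrictMono Phi := by
  intro a b hab
  have hpos : gaussianReal 0 1 (Set.Ioc a b) ≠ 0 := fun h => by
    have := gaussianReal_absolutelyContinuous' 0 one_ne_zero h
    exact hab.not_ge (by simpa using this)
  rw [← measure_cdf (gaussianReal 0 1), StieltjesFunction.measure_Ioc] at hpos
  rw [Phi_eq_cdf, Phi_eq_cdf]
  simpa using hpos

lemma Phi_mem_Ioo (x : ℝ) : Phi x ∈ Set.Ioo (0 : ℝ) 1 :=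
  ⟨(Phi_nonneg (x - 1)).trans_lt (Phi_strictMono (by linarith)),
    (Phi_strictMono (by linarith : x < x + 1)).trans_le (Phi_le_one _)⟩

lemma continuous_Phi : Continuous Phi := by
  have : Phi = cdf (gaussianReal 0 1) := funext Phi_eq_cdf
  rw [this, continuous_iff_continuousAt]
  intro x
  have hzero : gaussianReal 0 1 {x} = 0 := by
    have := nullSingletonClass_gaussianReal (μ := 0) (v := 1) one_ne_zero
    exact measure_singleton x
  rw [← measure_cdf (gaussianReal 0 1), StieltjesFunction.measure_singleton,
    ENNReal.ofReal_eq_zero] at hzero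
  have hle := (monotone_cdf (gaussianReal 0 1)).leftLim_le (le_refl x)
  refine continuousAt_iff_continuous_left'_right'.2
    ⟨((monotone_cdf _).continuousWithinAt_Iio_iff_leftLim_eq).2 (by linarith),
      ((cdf (gaussianReal 0 1)).right_continuous x).mono Set.Ioi_subset_Ici_self⟩

lemma PhiInv_le_iff {u : ℝ} (hu : u ∈ Set.Ioo (0 : ℝ) 1) (x : ℝ) :
    PhiInv u ≤ x ↔ u ≤ Phi x := by
  have hfun : Phi = cdf (gaussianReal 0 1) := funext Phi_eq_cdf
  have hne : {x | u ≤ Phi x}.Nonempty := by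
    have h : Tendsto Phi atTop (𝓝 1) := hfun ▸ tendsto_cdf_atTop _
    obtain ⟨z, hz⟩ := (h.eventually (eventually_gt_nhds hu.2)).exists
    exact ⟨z, le_of_lt hz⟩
  have hbdd : BddBelow {x | u ≤ Phi x} := by
    have h : Tendsto Phi atBot (𝓝 0) := hfun ▸ tendsto_cdf_atBot _
    obtain ⟨z, hz⟩ := (h.eventually (eventually_lt_nhds hu.1)).exists
    exact ⟨z, fun w hw => (Phi_strictMono.lt_iff_lt.1 (lt_of_lt_of_le hz hw)).le⟩
  have hclosed : IsClosed {x | u ≤ Phi x} := isClosed_le continuous_const continuous_Phi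
  exact ⟨fun h => le_trans (hclosed.csInf_mem hne hbdd) (Phi_strictMono.monotone h),
    fun h => csInf_le hbdd h⟩

lemma Phi_PhiInv {u : ℝ} (hu : u ∈ Set.Ioo (0 : ℝ) 1) : Phi (PhiInv u) = u := by
  refine le_antisymm ?_ ((PhiInv_le_iff hu _).1 le_rfl)
  refine continuous_Phi.continuousWithinAt.closure_le (s := Set.Iio (PhiInv u)) (by simp)
    continuousWithinAt_const fun x hx => ?_
  exact (lt_of_not_ge fun h => (not_le_of_gt hx) ((PhiInv_le_iff hu x).2 h)).le

lemma continuousOn_PhiInv : ContinuousOn PhiInv (Set.Ioo 0 1) := by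
  intro u hu
  refine tendsto_order.2 ⟨fun a ha => ?_, fun b hb => ?_⟩
  · have h : Phi a < u := Phi_PhiInv hu ▸ Phi_strictMono ha
    filter_upwards [self_mem_nhdsWithin, nhdsWithin_le_nhds (eventually_gt_nhds h)] with v hv hv'
    exact Phi_strictMono.lt_iff_lt.1 (by rwa [Phi_PhiInv hv])
  · have h : u < Phi b := by simpa only [Phi_PhiInv hu] using Phi_strictMono hb
    filter_upwards [self_mem_nhdsWithin, nhdsWithin_le_nhds (eventually_lt_nhds h)] with v hv hv'
    exact Phi_strictMono.lt_iff_lt.1 (by rwa [Phi_PhiInv hv])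

lemma measurable_PhiInv : Measurable PhiInv := by
  have h : PhiInv = (Set.Ioo (0 : ℝ) 1).piecewise PhiInv 0 := by
    ext u
    by_cases hu : u ∈ Set.Ioo (0 : ℝ) 1
    · simp [hu]
    · rw [Set.piecewise_eq_of_notMem _ _ _ hu, PhiInv]
      rcases le_or_gt u 0 with h0 | h0
      · simp [h0.trans (Phi_nonneg _)]
      · have h1 : 1 ≤ u := not_lt.1 fun h => hu ⟨h0, h⟩
        have : {x | u ≤ Phi x} = ∅ :=
          Set.eq_empty_of_forall_notMem fun x hx =>
            absurd (Phi_mem_Ioo x).2 (not_lt.2 (h1.trans hx))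
        simp [this]
  rw [h]
  exact continuousOn_PhiInv.measurable_piecewise continuousOn_const measurableSet_Ioo

/-- Averaging `Φ((q - ρ Z)/√(1 - ρ²))` over a standard normal `Z` yields `Φ(q)`. -/
lemma integral_Phi_affine {ρ : ℝ} (hρ : ρ ∈ Set.Ioo (-1 : ℝ) 1) (q : ℝ) :
    ∫ z, Phi ((q - ρ * z) / √(1 - ρ ^ 2)) ∂(gaussianReal 0 1) = Phi q := by
  have hs : 0 < 1 - ρ ^ 2 := by nlinarith [hρ.1, hρ.2]
  have hs' : 0 < √(1 - ρ ^ 2) := Real.sqrt_pos.2 hs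
  set s := √(1 - ρ ^ 2) with hsdef
  have hsq : s ^ 2 = 1 - ρ ^ 2 := Real.sq_sqrt hs.le
  have hconv : ((gaussianReal 0 1).map (ρ * ·)) ∗ ((gaussianReal 0 1).map (s * ·))
      = gaussianReal 0 1 := by
    rw [gaussianReal_map_const_mul, gaussianReal_map_const_mul, gaussianReal_conv_gaussianReal]
    congr 1
    · simp
    · ext
      simp [hsq]
  have hlint : ∫⁻ z, gaussianReal 0 1 (Set.Iic ((q - ρ * z) / s)) ∂(gaussianReal 0 1)
      = gaussianReal 0 1 (Set.Iic q) := by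
    conv_rhs => rw [← hconv, Measure.conv, Measure.map_apply (by fun_prop) measurableSet_Iic,
      Measure.map_prod_map _ _ (by fun_prop) (by fun_prop),
      Measure.map_apply (by fun_prop) (measurableSet_Iic.preimage (by fun_prop)),
      Measure.prod_apply ((measurableSet_Iic.preimage (by fun_prop)).preimage (by fun_prop))]
    refine lintegral_congr fun z => ?_
    congr 1
    ext w
    simp only [Set.mem_Iic, Set.mem_preimage, Prod.map_apply, le_div_iff₀ hs']
    constructor <;> intro h <;> linarith
  rw [integral_eq_lintegral_of_nonneg_ae (ae_of_all _ fun _ => Phi_nonneg _)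
    (continuous_Phi.comp (by fun_prop)).aestronglyMeasurable]
  simp only [Phi, ENNReal.ofReal_toReal (measure_ne_top _ _)]
  rw [hlint]

/-- A sub-Gaussian bound on the moment generating function, stated as a bound on a Lebesgue
integral. -/
lemma hasSubgaussianMGF_iff_lintegral {Ω : Type*} {mΩ : MeasurableSpace Ω} {μ : Measure Ω}
    {X : Ω → ℝ} (hX : AEMeasurable X μ) (c : NNReal) :
    HasSubgaussianMGF X c μ ↔
      ∀ t, ∫⁻ ω, ENNReal.ofReal (Real.exp (t * X ω)) ∂μ
        ≤ ENNReal.ofReal (Real.exp (c * t ^ 2 / 2)) := by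
  have hmeas (t : ℝ) : AEStronglyMeasurable (fun ω => Real.exp (t * X ω)) μ :=
    (Real.measurable_exp.comp_aemeasurable (hX.const_mul t)).aestronglyMeasurable
  have hpos (t : ℝ) : 0 ≤ᵐ[μ] fun ω => Real.exp (t * X ω) :=
    ae_of_all _ fun _ => (Real.exp_pos _).le
  constructor
  · intro h t
    rw [← ofReal_integral_eq_lintegral_ofReal (h.integrable_exp_mul t) (hpos t)]
    exact ENNReal.ofReal_le_ofReal (h.mgf_le t)
  · intro h
    have h_integrable (t : ℝ) : Integrable (fun ω => Real.exp (t * X ω)) μ :=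
      ⟨hmeas t, (hasFiniteIntegral_iff_ofReal (hpos t)).2 ((h t).trans_lt ENNReal.ofReal_lt_top)⟩
    refine ⟨h_integrable, fun t => ?_⟩
    have := h t
    rwa [← ofReal_integral_eq_lintegral_ofReal (h_integrable t) (hpos t),
      ENNReal.ofReal_le_ofReal_iff (Real.exp_pos _).le] at this

/-- Almost sure limits inherit a uniform sub-Gaussian bound. -/
lemma hasSubgaussianMGF_of_tendsto {Ω : Type*} {mΩ : MeasurableSpace Ω} {μ : Measure Ω}
    {X : ℕ → Ω → ℝ} {Y : Ω → ℝ} {c : NNReal} (hX : ∀ k, AEMeasurable (X k) μ)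
    (h : ∀ k, HasSubgaussianMGF (X k) c μ)
    (hlim : ∀ᵐ ω ∂μ, Tendsto (fun k => X k ω) atTop (𝓝 (Y ω))) :
    HasSubgaussianMGF Y c μ := by
  have hY : AEMeasurable Y μ := aemeasurable_of_tendsto_metrizable_ae' hX hlim
  rw [hasSubgaussianMGF_iff_lintegral hY]
  intro t
  calc ∫⁻ ω, ENNReal.ofReal (Real.exp (t * Y ω)) ∂μ
      = ∫⁻ ω, liminf (fun k => ENNReal.ofReal (Real.exp (t * X k ω))) atTop ∂μ := by
        refine lintegral_congr_ae ?_
        filter_upwards [hlim] with ω hω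
        exact (ENNReal.tendsto_ofReal ((Real.continuous_exp.tendsto _).comp
          (hω.const_mul t))).liminf_eq.symm
    _ ≤ liminf (fun k => ∫⁻ ω, ENNReal.ofReal (Real.exp (t * X k ω)) ∂μ) atTop :=
        lintegral_liminf_le' fun k =>
          (Real.measurable_exp.comp_aemeasurable ((hX k).const_mul t)).ennreal_ofReal
    _ ≤ ENNReal.ofReal (Real.exp (c * t ^ 2 / 2)) :=
        liminf_le_of_le (by isBoundedDefault) fun b hb => by
          obtain ⟨k, hk⟩ := hb.exists
          exact hk.trans ((hasSubgaussianMGF_iff_lintegral (hX k) c).1 (h k) t)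

/-- Adding to a sub-Gaussian variable `X` an increment `g W Z`, where `Z` is independent of
`(X, W)` and `g w Z` is sub-Gaussian for every value `w` of `W`, adds the two parameters. -/
lemma hasSubgaussianMGF_add_of_indepFun {Ω : Type*} {mΩ : MeasurableSpace Ω} {μ : Measure Ω}
    [IsProbabilityMeasure μ] {X W Z : Ω → ℝ} {g : ℝ → ℝ → ℝ} {c d : NNReal}
    (hX : Measurable X) (hW : Measurable W) (hZ : Measurable Z)
    (hg : Measurable (Function.uncurry g))
    (hind : IndepFun (fun ω => (X ω, W ω)) Z μ)
    (hXc : HasSubgaussianMGF X c μ) (hgd : ∀ ω, HasSubgaussianMGF (g (W ω)) d (μ.map Z)) :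
    HasSubgaussianMGF (fun ω => X ω + g (W ω) (Z ω)) (c + d) μ := by
  have hXW : Measurable fun ω => (X ω, W ω) := hX.prodMk hW
  have hsum : Measurable fun ω => X ω + g (W ω) (Z ω) := hX.add (hg.comp (hW.prodMk hZ))
  have : IsProbabilityMeasure (μ.map Z) := Measure.isProbabilityMeasure_map hZ.aemeasurable
  rw [hasSubgaussianMGF_iff_lintegral hsum.aemeasurable]
  intro t
  have hF : Measurable fun p : (ℝ × ℝ) × ℝ =>
      ENNReal.ofReal (Real.exp (t * p.1.1)) * ENNReal.ofReal (Real.exp (t * g p.1.2 p.2)) := by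
    have : Measurable fun p : (ℝ × ℝ) × ℝ => g p.1.2 p.2 :=
      hg.comp (f := fun p : (ℝ × ℝ) × ℝ => (p.1.2, p.2)) (by fun_prop)
    fun_prop
  calc ∫⁻ ω, ENNReal.ofReal (Real.exp (t * (X ω + g (W ω) (Z ω)))) ∂μ
      = ∫⁻ ω, ENNReal.ofReal (Real.exp (t * X ω))
          * ENNReal.ofReal (Real.exp (t * g (W ω) (Z ω))) ∂μ := by
        simp_rw [mul_add, Real.exp_add, ENNReal.ofReal_mul (Real.exp_pos _).le]
    _ = ∫⁻ ω, ∫⁻ z, ENNReal.ofReal (Real.exp (t * X ω))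
          * ENNReal.ofReal (Real.exp (t * g (W ω) z)) ∂(μ.map Z) ∂μ := by
        rw [← lintegral_map (f := fun p : (ℝ × ℝ) × ℝ => ENNReal.ofReal (Real.exp (t * p.1.1))
            * ENNReal.ofReal (Real.exp (t * g p.1.2 p.2))) hF (hXW.prodMk hZ),
          (indepFun_iff_map_prod_eq_prod_map_map hXW.aemeasurable hZ.aemeasurable).1 hind,
          lintegral_prod _ hF.aemeasurable, lintegral_map hF.lintegral_prod_right' hXW]
    _ ≤ ∫⁻ ω, ENNReal.ofReal (Real.exp (t * X ω))
          * ENNReal.ofReal (Real.exp (d * t ^ 2 / 2)) ∂μ := by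
        refine lintegral_mono fun ω => ?_
        have hgω : Measurable (g (W ω)) := hg.of_uncurry_left
        rw [lintegral_const_mul _ (by fun_prop)]
        gcongr
        exact (hasSubgaussianMGF_iff_lintegral hgω.aemeasurable d).1 (hgd ω) t
    _ ≤ ENNReal.ofReal (Real.exp (c * t ^ 2 / 2))
          * ENNReal.ofReal (Real.exp (d * t ^ 2 / 2)) := by
        rw [lintegral_mul_const _ (by fun_prop)]
        gcongr
        exact (hasSubgaussianMGF_iff_lintegral hX.aemeasurable c).1 hXc t
    _ = ENNReal.ofReal (Real.exp ((c + d : NNReal) * t ^ 2 / 2)) := by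
        rw [← ENNReal.ofReal_mul (Real.exp_pos _).le, ← Real.exp_add]
        push_cast
        ring_nf

lemma Hcop_of_mem_Ioo {u : ℝ} (hu : u ∈ Set.Ioo (0 : ℝ) 1) (ρ v : ℝ) :
    Hcop ρ u v = Phi ((PhiInv u - ρ * PhiInv v) / √(1 - ρ ^ 2)) := by
  rw [Hcop, if_neg hu.1.ne', if_neg hu.2.ne]

/-- Hoeffding's lemma for the increment of the copula update driven by a normal score. -/
lemma hasSubgaussianMGF_copula_increment {ρ : ℝ} (hρ : ρ ∈ Set.Ioo (-1 : ℝ) 1) (a : ℝ)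
    {p : ℝ} (hp : p ∈ Set.Ioo (0 : ℝ) 1) :
    HasSubgaussianMGF (fun z => a * (Phi ((PhiInv p - ρ * z) / √(1 - ρ ^ 2)) - p))
      ((‖a‖₊ / 2) ^ 2) (gaussianReal 0 1) := by
  have hmeas : Measurable fun z => Phi ((PhiInv p - ρ * z) / √(1 - ρ ^ 2)) - p :=
    (continuous_Phi.comp (by fun_prop)).measurable.sub_const p
  have h := hasSubgaussianMGF_of_mem_Icc_of_integral_eq_zero (μ := gaussianReal 0 1)
    (a := 0 - p) (b := 1 - p) hmeas.aemeasurable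
    (ae_of_all _ fun z => ⟨by simpa using Phi_nonneg _, by simpa using Phi_le_one _⟩) (by
      rw [integral_sub _ (integrable_const p), integral_Phi_affine hρ, Phi_PhiInv hp]
      · simp
      · exact Integrable.of_mem_Icc 0 1 (continuous_Phi.comp (by fun_prop)).aemeasurable
          (ae_of_all _ fun z => ⟨Phi_nonneg _, Phi_le_one _⟩))
  convert h.const_mul a using 1
  ext
  change (|a| / 2) ^ 2 = a ^ 2 * (|1 - p - (0 - p)| / 2) ^ 2
  rw [show 1 - p - (0 - p) = 1 by ring, abs_one, div_pow, sq_abs]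
  ring

namespace CopulaProcess

variable {Ω : Type*} [mΩ : MeasurableSpace Ω] {P : Measure Ω}

lemma Pk_succ (Q : CopulaProcess Ω P) (k : ℕ) (ω : Ω) (t : ℝ) :
    Q.Pk (k + 1) ω t = (1 - Q.α (Q.n + (k + 1))) * Q.Pk k ω t
      + Q.α (Q.n + (k + 1)) * Hcop Q.ρ (Q.Pk k ω t) (Q.Pk k ω (Q.y (k + 1) ω)) :=
  Q.step (k + 1) (by omega) ω t

lemma Pk_mem_Ioo (Q : CopulaProcess Ω P) (k : ℕ) (ω : Ω) (t : ℝ) :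
    Q.Pk k ω t ∈ Set.Ioo (0 : ℝ) 1 := by
  induction k with
  | zero => exact Q.mem0 ω t
  | succ k ih =>
    have hα := Q.hα (k + 1) (by omega)
    rw [Q.Pk_succ, Hcop_of_mem_Ioo ih]
    exact convex_Ioo (𝕜 := ℝ) (0 : ℝ) 1 ih (Phi_mem_Ioo _) (by linarith [hα.2]) hα.1.le
      (by ring)

lemma continuous_Pk (Q : CopulaProcess Ω P) (k : ℕ) (ω : Ω) : Continuous (Q.Pk k ω) := by
  induction k with
  | zero => exact Q.cont0 ω
  | succ k ih =>
    have hinv : Continuous fun t => PhiInv (Q.Pk k ω t) :=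
      continuousOn_PhiInv.comp_continuous ih (Q.Pk_mem_Ioo k ω)
    have hPhi := continuous_Phi
    have : Q.Pk (k + 1) ω = fun t => (1 - Q.α (Q.n + (k + 1))) * Q.Pk k ω t
        + Q.α (Q.n + (k + 1)) * Phi ((PhiInv (Q.Pk k ω t)
          - Q.ρ * PhiInv (Q.Pk k ω (Q.y (k + 1) ω))) / √(1 - Q.ρ ^ 2)) := by
      ext t
      rw [Q.Pk_succ, Hcop_of_mem_Ioo (Q.Pk_mem_Ioo k ω t)]
    rw [this]
    fun_prop

/-- The normal score of the probability integral transform of the `(k+1)`-st sample. -/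
noncomputable def normalScore (Q : CopulaProcess Ω P) (k : ℕ) (ω : Ω) : ℝ :=
  PhiInv (Q.Pk k ω (Q.y (k + 1) ω))

lemma Pk_succ_eq_add (Q : CopulaProcess Ω P) (k : ℕ) (ω : Ω) (t : ℝ) :
    Q.Pk (k + 1) ω t = Q.Pk k ω t + Q.α (Q.n + (k + 1)) *
      (Phi ((PhiInv (Q.Pk k ω t) - Q.ρ * Q.normalScore k ω) / √(1 - Q.ρ ^ 2))
        - Q.Pk k ω t) := by
  rw [Q.Pk_succ, Hcop_of_mem_Ioo (Q.Pk_mem_Ioo k ω t), normalScore]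
  ring

lemma measurable_normalScore_of_Pk (Q : CopulaProcess Ω P) (k : ℕ)
    (h : ∀ t, Measurable[Q.ℱ k] fun ω => Q.Pk k ω t) :
    Measurable[Q.ℱ (k + 1)] (Q.normalScore k) := by
  have h' (t : ℝ) : Measurable[Q.ℱ (k + 1)] fun ω => Q.Pk k ω t :=
    (h t).mono (Q.ℱ.mono k.le_succ) le_rfl
  have hy : Measurable[Q.ℱ (k + 1)] (Q.y (k + 1)) := (Q.measy (k + 1) (by omega)).measurable
  have hu := measurable_uncurry_of_continuous_of_measurable (m := Q.ℱ (k + 1))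
    (u := fun t ω => Q.Pk k ω t) (fun ω => Q.continuous_Pk k ω) h'
  exact measurable_PhiInv.comp (hu.comp (hy.prodMk (@measurable_id _ (Q.ℱ (k + 1)))))

lemma measurable_Pk (Q : CopulaProcess Ω P) (k : ℕ) (t : ℝ) :
    Measurable[Q.ℱ k] fun ω => Q.Pk k ω t := by
  induction k generalizing t with
  | zero => exact (Q.meas0 t).measurable
  | succ k ih =>
    have hZ := Q.measurable_normalScore_of_Pk k ih
    have hP : Measurable[Q.ℱ (k + 1)] fun ω => Q.Pk k ω t :=
      (ih t).mono (Q.ℱ.mono k.le_succ) le_rfl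
    have hPhi := continuous_Phi.measurable
    have hInv := measurable_PhiInv
    simp only [Q.Pk_succ_eq_add]
    fun_prop

lemma measurable_normalScore (Q : CopulaProcess Ω P) (k : ℕ) : Measurable (Q.normalScore k) :=
  (Q.measurable_normalScore_of_Pk k (Q.measurable_Pk k)).mono (Q.ℱ.le _) le_rfl

/-- The normal score is standard normal and independent of the past. -/
lemma measure_inter_normalScore_preimage [IsProbabilityMeasure P] (Q : CopulaProcess Ω P)
    (k : ℕ) {A : Set Ω} (hA : MeasurableSet[Q.ℱ k] A) {B : Set ℝ} (hB : MeasurableSet B) :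
    P (A ∩ Q.normalScore k ⁻¹' B) = P A * gaussianReal 0 1 B := by
  have hA' : MeasurableSet A := Q.ℱ.le k A hA
  have hZ := Q.measurable_normalScore k
  have hfin : IsFiniteMeasure ((P.restrict A).map (Q.normalScore k)) :=
    Measure.isFiniteMeasure_map _ _
  have h : (P.restrict A).map (Q.normalScore k) = P A • gaussianReal 0 1 := by
    refine Measure.ext_of_Iic _ _ fun x => ?_
    rw [Measure.map_apply hZ measurableSet_Iic,
      Measure.restrict_apply (measurableSet_Iic.preimage hZ), Set.inter_comm,
      Measure.smul_apply, smul_eq_mul]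
    have hset : Q.normalScore k ⁻¹' Set.Iic x
        = {ω | Q.Pk k ω (Q.y (k + 1) ω) ≤ Phi x} :=
      Set.ext fun ω => PhiInv_le_iff (Q.Pk_mem_Ioo k ω _) x
    rw [hset]
    have hunif := Q.unif (k + 1) (by omega) A hA (Phi x) ⟨Phi_nonneg x, Phi_le_one x⟩
    rwa [Phi, ENNReal.ofReal_toReal (measure_ne_top _ _)] at hunif
  have := congrArg (fun μ => μ B) h
  simp only [Measure.smul_apply, smul_eq_mul] at this
  rw [Measure.map_apply hZ hB, Measure.restrict_apply (hB.preimage hZ), Set.inter_comm] at this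
  exact this

lemma map_normalScore [IsProbabilityMeasure P] (Q : CopulaProcess Ω P) (k : ℕ) :
    P.map (Q.normalScore k) = gaussianReal 0 1 := by
  ext B hB
  rw [Measure.map_apply (Q.measurable_normalScore k) hB]
  simpa using Q.measure_inter_normalScore_preimage k MeasurableSet.univ hB

/-- Azuma-Hoeffding: the fluctuation of the process up to step `M` is sub-Gaussian. -/
lemma hasSubgaussianMGF_Pk_sub [IsProbabilityMeasure P] (Q : CopulaProcess Ω P) (t : ℝ) (M : ℕ) :
    HasSubgaussianMGF (fun ω => Q.Pk M ω t - Q.Pk 0 ω t)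
      (∑ i ∈ Finset.range M, (‖Q.α (Q.n + (i + 1))‖₊ / 2) ^ 2) P := by
  induction M with
  | zero => simp
  | succ k ih =>
    have hP := Q.measurable_Pk k t
    have h0 : Measurable[Q.ℱ k] fun ω => Q.Pk 0 ω t :=
      (Q.measurable_Pk 0 t).mono (Q.ℱ.mono k.zero_le) le_rfl
    have hX : Measurable[Q.ℱ k] fun ω => Q.Pk k ω t - Q.Pk 0 ω t := hP.sub h0
    have hZ := Q.measurable_normalScore k
    have hPhi := continuous_Phi.measurable
    have hInv := measurable_PhiInv
    rw [Finset.sum_range_succ]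
    refine (hasSubgaussianMGF_add_of_indepFun (hX.mono (Q.ℱ.le k) le_rfl)
      (hP.mono (Q.ℱ.le k) le_rfl) hZ
      (g := fun p z => Q.α (Q.n + (k + 1)) *
        (Phi ((PhiInv p - Q.ρ * z) / √(1 - Q.ρ ^ 2)) - p))
      (by unfold Function.uncurry; fun_prop) ?_ ih fun ω => ?_).congr (ae_of_all _ fun ω => ?_)
    · refine indepFun_iff_measure_inter_preimage_eq_mul.2 fun A B hA hB => ?_
      rw [Q.measure_inter_normalScore_preimage k (hX.prodMk hP hA) hB,
        ← Measure.map_apply hZ hB, Q.map_normalScore]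
    · rw [Q.map_normalScore]
      exact hasSubgaussianMGF_copula_increment Q.hρ _ (Q.Pk_mem_Ioo k ω t)
    · simp only [Q.Pk_succ_eq_add k]
      ring

/-- Deviation of the martingale limit from the initialization. -/
lemma measureReal_le_abs_limit_sub_le [IsProbabilityMeasure P] (Q : CopulaProcess Ω P)
    {t S : ℝ} (hS : ∀ M, ∑ i ∈ Finset.range M, Q.α (Q.n + (i + 1)) ^ 2 ≤ S) {Y : Ω → ℝ}
    (hY : ∀ᵐ ω ∂P, Tendsto (fun M => Q.Pk M ω t) atTop (𝓝 (Y ω))) {ε : ℝ} (hε : 0 ≤ ε) :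
    P.real {ω | ε ≤ |Y ω - Q.Pk 0 ω t|} ≤ 2 * Real.exp (-(2 * ε ^ 2 / S)) := by
  have hS0 : 0 ≤ S := by simpa using hS 0
  have hc (M : ℕ) : HasSubgaussianMGF (fun ω => Q.Pk M ω t - Q.Pk 0 ω t)
      (Real.toNNReal (S / 4)) P := by
    refine ⟨(Q.hasSubgaussianMGF_Pk_sub t M).1,
      fun s => ((Q.hasSubgaussianMGF_Pk_sub t M).2 s).trans ?_⟩
    have : ((∑ i ∈ Finset.range M, (‖Q.α (Q.n + (i + 1))‖₊ / 2) ^ 2 : NNReal) : ℝ) ≤ S / 4 := by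
      push_cast
      simp only [div_pow, Real.norm_eq_abs, sq_abs, ← Finset.sum_div]
      linarith [hS M]
    rw [Real.coe_toNNReal _ (by positivity)]
    gcongr
  have hmeas (M : ℕ) : AEMeasurable (fun ω => Q.Pk M ω t - Q.Pk 0 ω t) P :=
    (((Q.measurable_Pk M t).mono (Q.ℱ.le M) le_rfl).sub
      ((Q.measurable_Pk 0 t).mono (Q.ℱ.le 0) le_rfl)).aemeasurable
  have hlim : HasSubgaussianMGF (fun ω => Y ω - Q.Pk 0 ω t) (Real.toNNReal (S / 4)) P :=
    hasSubgaussianMGF_of_tendsto hmeas hc (hY.mono fun ω hω => hω.sub_const _)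
  have hexp : -ε ^ 2 / (2 * ((Real.toNNReal (S / 4) : NNReal) : ℝ)) = -(2 * ε ^ 2 / S) := by
    rw [Real.coe_toNNReal _ (by positivity)]
    rcases hS0.eq_or_lt with h | h
    · simp [← h]
    · field_simp
      norm_num
  have h1 := hlim.measure_ge_le hε
  have h2 := hlim.neg.measure_ge_le hε
  rw [hexp] at h1 h2
  calc P.real {ω | ε ≤ |Y ω - Q.Pk 0 ω t|}
      ≤ P.real ({ω | ε ≤ Y ω - Q.Pk 0 ω t} ∪ {ω | ε ≤ (-fun ω => Y ω - Q.Pk 0 ω t) ω}) :=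
        measureReal_mono fun ω (hω : ε ≤ |_|) => le_abs.1 hω
    _ ≤ _ := (measureReal_union_le _ _).trans (by linarith)

end CopulaProcess

/-- Integral comparison for the tail of a `p`-series with `p > 1`. -/
lemma sum_range_rpow_neg_le {p : ℝ} (hp : 1 < p) {n : ℕ} (hn : 1 ≤ n) (M : ℕ) :
    ∑ i ∈ Finset.range M, ((n : ℝ) + (i + 1 : ℕ) + 1) ^ (-p) ≤ (n : ℝ) ^ (1 - p) / (p - 1) := by
  have hn' : (0 : ℝ) < n := by exact_mod_cast hn
  have hanti : AntitoneOn (fun x : ℝ => x ^ (-p)) (Set.Icc (n : ℝ) (n + M)) :=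
    fun x hx y _ hxy =>
      Real.rpow_le_rpow_of_nonpos (hn'.trans_le hx.1) hxy (by linarith)
  calc ∑ i ∈ Finset.range M, ((n : ℝ) + (i + 1 : ℕ) + 1) ^ (-p)
      ≤ ∑ i ∈ Finset.range M, ((n : ℝ) + (i + 1 : ℕ)) ^ (-p) :=
        Finset.sum_le_sum fun i _ =>
          Real.rpow_le_rpow_of_nonpos (by positivity) (by linarith) (by linarith)
    _ ≤ ∫ x in (n : ℝ)..n + M, x ^ (-p) := hanti.sum_le_integral
    _ = ((n : ℝ) ^ (1 - p) - ((n : ℝ) + M) ^ (1 - p)) / (p - 1) := by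
        rw [integral_rpow (Or.inr ⟨by linarith, fun h => by
          rw [Set.uIcc_of_le (by simp)] at h
          linarith [h.1]⟩), show -p + 1 = 1 - p by ring, ← neg_sub p 1, div_neg, ← neg_div,
          neg_sub]
    _ ≤ (n : ℝ) ^ (1 - p) / (p - 1) := by
        have : 0 < p - 1 := by linarith
        gcongr
        linarith [Real.rpow_nonneg (by positivity : (0 : ℝ) ≤ (n : ℝ) + M) (1 - p)]

/-- (Corollary 1) For two copula-update processes on the same probability space with the
same `ρ`, the same `n`, and the same learning rates `α_{n+k} = C·(n+k+1)^{−β}`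
(`C > 0`, `β ∈ (1/2, 1]`), but possibly different initializations and sampled sequences,
the martingale limits satisfy, for every fixed `y` and `δ ∈ (0,1)`, with probability at
least `1 − 2δ`,
`|P_{∞,1}(y) − P_{∞,2}(y)| ≥ |P_{0,1}(y) − P_{0,2}(y)| − 2·√(C²·log(2/δ)/(2β − 1))·n^{1/2 − β}`. -/
theorem copulaProcess_initialization_dominates {Ω : Type*} [mΩ : MeasurableSpace Ω]
    (P : Measure Ω) [IsProbabilityMeasure P]
    (Q₁ Q₂ : CopulaProcess Ω P)
    (hρeq : Q₁.ρ = Q₂.ρ) (hneq : Q₁.n = Q₂.n) (hαeq : Q₁.α = Q₂.α)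
    (C β : ℝ) (hC : 0 < C) (hβ : β ∈ Set.Ioc (1 / 2 : ℝ) 1)
    (hrate : ∀ k, 1 ≤ k → Q₁.α (Q₁.n + k) = C * ((Q₁.n : ℝ) + k + 1) ^ (-β))
    (Pinf₁ Pinf₂ : ℝ → Ω → ℝ)
    (hPinf₁ : ∀ t : ℝ, ∀ᵐ ω ∂P, Tendsto (fun M => Q₁.Pk M ω t) atTop (𝓝 (Pinf₁ t ω)))
    (hPinf₂ : ∀ t : ℝ, ∀ᵐ ω ∂P, Tendsto (fun M => Q₂.Pk M ω t) atTop (𝓝 (Pinf₂ t ω)))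
    (t : ℝ) (δ : ℝ) (hδ : δ ∈ Set.Ioo (0 : ℝ) 1) :
    ENNReal.ofReal (1 - 2 * δ) ≤
      P {ω | |Q₁.Pk 0 ω t - Q₂.Pk 0 ω t| -
          2 * Real.sqrt (C ^ 2 * Real.log (2 / δ) / (2 * β - 1)) *
            (Q₁.n : ℝ) ^ (1 / 2 - β) ≤
        |Pinf₁ t ω - Pinf₂ t ω|} := by
  obtain ⟨hβ₀, -⟩ := hβ
  obtain ⟨hδ₀, hδ₁⟩ := hδ
  have hn : (0 : ℝ) < Q₁.n := by exact_mod_cast Q₁.hn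
  have hβ' : 0 < 2 * β - 1 := by linarith
  have hL : 0 < Real.log (2 / δ) := Real.log_pos (by rw [lt_div_iff₀ hδ₀]; linarith)
  set L := Real.log (2 / δ) with hLdef
  set S : ℝ := C ^ 2 * ((Q₁.n : ℝ) ^ (1 - 2 * β) / (2 * β - 1)) with hSdef
  have hS : 0 < S := by positivity
  have hS₁ (M : ℕ) : ∑ i ∈ Finset.range M, Q₁.α (Q₁.n + (i + 1)) ^ 2 ≤ S := by
    refine le_trans (le_of_eq ?_) (mul_le_mul_of_nonneg_left
      (sum_range_rpow_neg_le (by linarith : 1 < 2 * β) Q₁.hn M) (sq_nonneg C))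
    rw [Finset.mul_sum]
    refine Finset.sum_congr rfl fun i _ => ?_
    rw [hrate (i + 1) (by omega), mul_pow, ← Real.rpow_mul_natCast (by positivity)]
    congr 2
    push_cast
    ring
  have hS₂ (M : ℕ) : ∑ i ∈ Finset.range M, Q₂.α (Q₂.n + (i + 1)) ^ 2 ≤ S := by
    rw [← hneq, ← hαeq]
    exact hS₁ M
  set ε := Real.sqrt (C ^ 2 * L / (2 * β - 1)) * (Q₁.n : ℝ) ^ (1 / 2 - β) with hεdef
  have hε : 0 ≤ ε := by positivity
  have hε2 : ε ^ 2 = L * S := by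
    rw [hεdef, mul_pow, Real.sq_sqrt (by positivity), ← Real.rpow_mul_natCast hn.le,
      show (1 / 2 - β) * ((2 : ℕ) : ℝ) = 1 - 2 * β by push_cast; ring, hSdef]
    ring
  have htail : 2 * Real.exp (-(2 * ε ^ 2 / S)) ≤ δ := by
    have h : Real.exp (-(2 * ε ^ 2 / S)) ≤ Real.exp (-L) := by
      rw [hε2, ← mul_assoc, mul_div_cancel_right₀ _ hS.ne']
      exact Real.exp_le_exp.2 (by linarith)
    rw [Real.exp_neg L, hLdef, Real.exp_log (by positivity), inv_div] at h
    linarith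
  have h₁ := (Q₁.measureReal_le_abs_limit_sub_le hS₁ (hPinf₁ t) hε).trans htail
  have h₂ := (Q₂.measureReal_le_abs_limit_sub_le hS₂ (hPinf₂ t) hε).trans htail
  set A := {ω | |Q₁.Pk 0 ω t - Q₂.Pk 0 ω t| -
          2 * Real.sqrt (C ^ 2 * L / (2 * β - 1)) *
            (Q₁.n : ℝ) ^ (1 / 2 - β) ≤
        |Pinf₁ t ω - Pinf₂ t ω|} with hA
  have hsub : Aᶜ ⊆ {ω | ε ≤ |Pinf₁ t ω - Q₁.Pk 0 ω t|} ∪ {ω | ε ≤ |Pinf₂ t ω - Q₂.Pk 0 ω t|} := by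
    intro ω hω
    by_contra! hcon
    simp only [Set.mem_union, Set.mem_ofPred_eq, not_or, not_le] at hcon
    refine hω ?_
    rw [hA, Set.mem_ofPred_eq, mul_assoc, ← hεdef]
    have := abs_sub_le (Q₁.Pk 0 ω t) (Pinf₁ t ω) (Q₂.Pk 0 ω t)
    have := abs_sub_le (Pinf₁ t ω) (Pinf₂ t ω) (Q₂.Pk 0 ω t)
    rw [abs_sub_comm (Q₁.Pk 0 ω t) (Pinf₁ t ω)] at *
    linarith [hcon.1, hcon.2]
  have hcompl : P.real Aᶜ ≤ 2 * δ :=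
    ((measureReal_mono hsub).trans (measureReal_union_le _ _)).trans (by linarith)
  have huniv : (1 : ℝ) ≤ P.real A + P.real Aᶜ := by
    simpa using measureReal_union_le (μ := P) A Aᶜ
  exact ENNReal.ofReal_le_of_le_toReal (by change _ ≤ P.real A; linarith)
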